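/- Let n, α, k, j be natural numbers with n ≥ 2, α ≥ 1, k ≥ 2, j ∈ {k−2, k−1} (with j = 1 when k = 2), n ∤ j, j ≥ 1, and n^α · j ≤ k − 1. Then n = 2, α = 1, and k = 3. -/

import Mathlib

theorem exceptional_case_pinned_down (n α k j : ℕ)
    (hn : 2 ≤ n) (hα : 1 ≤ α) (hk : 2 ≤ k)
    (hj : j = k - 2 ∨ j = k - 1) (hj2 : k = 2 → j = 1)
    (hnd : ¬ n ∣ j) (hj1 : 1 ≤ j)
    (hle : n ^ α * j ≤ k - 1) :
    n = 2 ∧ α = 1 ∧ k = 3 := by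
  have h1 : n ≤ n ^ α := Nat.le_self_pow (by omega) n
  have h2 : α < n ^ α := Nat.lt_pow_self (by omega)
  have h3 : 2 * j ≤ n ^ α * j := Nat.mul_le_mul_right j (hn.trans h1)
  have h4 : j = 1 := by omega
  subst h4
  rw [mul_one] at hle
  refine ⟨?_, ?_, ?_⟩ <;> omega
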